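/- Let d ≥ 3. Let (X_t)_{t≥0} be a jointly measurable stationary ℝ^d-valued process on a probability space whose one-dimensional marginal has a bounded density μ with respect to Lebesgue measure, with μ in the anisotropic Hölder class H_d(β, L). Assume there is a constant C₀ such that for every T > 0 and every bounded measurable f : ℝ^d → ℝ whose support S has Lebesgue measure |S| < 1: Var(∫_0^T f(X_t) dt) ≤ C₀ T ‖f‖_∞² |S|^{1+2/d}. Let K be a kernel function satisfying ∫_ℝ K = 1, ‖K‖_∞ < ∞, supp(K) ⊆ [−1,1], ∫_ℝ K(x) x^l dx = 0 for l ∈ {1,…,M}, with M ≥ max_i β_i, and define the kernel estimator μ̂_{h,T}(x) = (1/(T ∏_{l=1}^d h_l)) ∫_0^T ∏_{m=1}^d K((x_m − X_u^m)/h_m) du. Then there is a constant C, independent of x, T and h, such that: (i) for every x ∈ ℝ^d, T > 0 and h ∈ (0,1]^d with 2^d ∏_{l=1}^d h_l < 1, E[|μ̂_{h,T}(x) − μ(x)|²] ≤ C ( Σ_{l=1}^d h_l^{2β_l} + T^{−1} (∏_{l=1}^d h_l)^{(2/d)−1} ); (ii) with the rate-optimal choice h_l = h_l(T) = T^{−β̄/(β_l(2β̄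 + d − 2))}, where 1/β̄ = (1/d) Σ_{l=1}^d 1/β_l, one has E[|μ̂_{h(T),T}(x) − μ(x)|²] ≤ C T^{−2β̄/(2β̄ + d − 2)} for all sufficiently large T and all x ∈ ℝ^d. -/

import Mathlib

open Real MeasureTheory Finset

/-- Iterated partial derivative in coordinate direction `i`. -/
noncomputable def pderivIter (d : ℕ) (i : Fin d) :
    ℕ → (EuclideanSpace ℝ (Fin d) → ℝ) → EuclideanSpace ℝ (Fin d) → ℝ
  | 0, g => g
  | k + 1, g => fun x => fderiv ℝ (pderivIter d i k g) x (EuclideanSpace.single i 1)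

/-- Largest integer strictly smaller than `b` (for `b > 0`). -/
noncomputable def flr (b : ℝ) : ℕ := ⌈b⌉₊ - 1

/-- The anisotropic Hölder class `H_d(β, L)`. -/
def memHolder (d : ℕ) (β L : Fin d → ℝ) (g : EuclideanSpace ℝ (Fin d) → ℝ) : Prop :=
  ∀ i : Fin d,
    (∀ k ≤ flr (β i), ∀ x, |pderivIter d i k g x| ≤ L i) ∧
    (∀ k < flr (β i), Differentiable ℝ (pderivIter d i k g)) ∧
    (∀ t : ℝ, ∀ x, |pderivIter d i (flr (β i)) g (x + t • EuclideanSpace.single i 1)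
        - pderivIter d i (flr (β i)) g x| ≤ L i * |t| ^ (β i - (flr (β i) : ℝ)))


theorem taylor_aux (L γ : ℝ) (hL : 0 ≤ L) (hγ : 0 < γ) (n : ℕ) : ∀ (φ : ℕ → ℝ → ℝ),
    (∀ k < n, ∀ s, HasDerivAt (φ k) (φ (k+1) s) s) →
    (∀ s, |φ n s - φ n 0| ≤ L * |s| ^ γ) →
    ∀ s, |φ 0 s - ∑ k ∈ Finset.range (n+1), φ k 0 * (s ^ k / (k.factorial : ℝ))| ≤ L * |s| ^ (n + γ) := by
  induction n with
  | zero =>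
    intro φ _ h s
    simpa using h s
  | succ n ih =>
    intro φ hd h s
    have ih' := ih (fun k => φ (k+1)) (fun k hk => hd (k+1) (by omega)) h
    set R : ℝ → ℝ := fun s => φ 0 s - ∑ k ∈ Finset.range (n+1+1), φ k 0 * (s ^ k / (k.factorial : ℝ)) with hR
    have hderiv : ∀ u, HasDerivAt R (φ 1 u - ∑ k ∈ Finset.range (n+1), φ (k+1) 0 * (u ^ k / (k.factorial : ℝ))) u := by
      intro u
      rw [hR]
      refine (hd 0 (by omega) u).sub ?_
      have : HasDerivAt (fun s : ℝ => ∑ k ∈ Finset.range (n+1+1), φ k 0 * (s ^ k / (k.factorial : ℝ)))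
          (∑ k ∈ Finset.range (n+1+1), φ k 0 * ((k * u ^ (k-1)) / (k.factorial : ℝ))) u := by
        refine HasDerivAt.fun_sum fun k _ => ?_
        exact ((hasDerivAt_pow k u).div_const _).const_mul _
      refine this.congr_deriv ?_
      rw [Finset.sum_range_succ' _ (n+1)]
      simp only [Nat.cast_zero, zero_mul, zero_div, mul_zero, add_zero]
      refine Finset.sum_congr rfl fun k _ => ?_
      rw [Nat.factorial_succ]
      push_cast
      have : (k.factorial : ℝ) ≠ 0 := by positivity
      have : (k + 1 : ℝ) ≠ 0 := by positivity
      try simp only [Nat.add_sub_cancel]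
      field_simp
    have hR0 : R 0 = 0 := by
      simp only [hR]
      rw [Finset.sum_range_succ']
      simp
    have hconv : Convex ℝ (Set.Icc (-|s|) |s|) := convex_Icc _ _
    have key := hconv.norm_image_sub_le_of_norm_hasDerivWithin_le (f := R) (x := 0) (y := s)
      (C := L * |s| ^ ((n:ℝ) + γ)) (fun u _ => (hderiv u).hasDerivWithinAt) (by
        intro u hu
        rw [Real.norm_eq_abs]
        refine (ih' u).trans ?_
        have : |u| ≤ |s| := abs_le.2 hu
        gcongr) ⟨by simp, by simp⟩ ⟨neg_abs_le s, le_abs_self s⟩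
    rw [hR0] at key
    simp only [sub_zero, Real.norm_eq_abs] at key
    refine key.trans (le_of_eq ?_)
    push_cast
    rcases eq_or_ne s 0 with rfl | hs
    · simp; right; rw [Real.zero_rpow (by positivity)]
    · rw [show (n:ℝ) + 1 + γ = (n + γ) + 1 by ring, Real.rpow_add_one (by positivity)]; ring

/-- One-dimensional bias. -/
theorem bias1 (L γ : ℝ) (hL : 0 ≤ L) (hγ : 0 < γ) (n : ℕ) (φ : ℕ → ℝ → ℝ)
    (hd : ∀ k < n, ∀ s, HasDerivAt (φ k) (φ (k+1) s) s)
    (hh : ∀ s, |φ n s - φ n 0| ≤ L * |s| ^ γ) (hφm : Measurable (φ 0)) (B : ℝ) (hφB : ∀ s, |φ 0 s| ≤ B)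
    (K : ℝ → ℝ) (hK_meas : Measurable K) (hK_int : ∫ x, K x = 1)
    (MK : ℝ) (hK_bdd : ∀ x, |K x| ≤ MK)
    (hK_supp : Function.support K ⊆ Set.Icc (-1) 1)
    (hK_mom : ∀ l : ℕ, 1 ≤ l → l ≤ n → ∫ x, K x * x ^ l = 0) (h : ℝ) (hpos : 0 < h) :
    |(∫ u, K u * φ 0 (-h * u)) - φ 0 0| ≤ 2 * MK * L * h ^ (n + γ) := by
  have hMK : 0 ≤ MK := (abs_nonneg _).trans (hK_bdd 0)
  have hKi : Integrable K := by
    have : IntegrableOn K (Set.Icc (-1) 1) :=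
      Measure.integrableOn_of_bounded (M := MK) (by simp) hK_meas.aestronglyMeasurable
        (Filter.Eventually.of_forall hK_bdd)
    rwa [integrableOn_iff_integrable_of_support_subset hK_supp] at this
  have hK0 : ∀ x, x ∉ Set.Icc (-1:ℝ) 1 → K x = 0 := fun x hx => by
    by_contra hne; exact hx (hK_supp hne)
  have hKp : ∀ k : ℕ, Integrable (fun x => K x * x ^ k) := by
    intro k
    refine hKi.mono (by fun_prop) (Filter.Eventually.of_forall fun x => ?_)
    by_cases hx : x ∈ Set.Icc (-1:ℝ) 1
    · rw [norm_mul, norm_pow]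
      have : ‖x‖ ≤ 1 := abs_le.2 hx
      exact mul_le_of_le_one_right (norm_nonneg _) (pow_le_one₀ (norm_nonneg _) this)
    · simp [hK0 x hx]
  have hKφ : Integrable (fun u => K u * φ 0 (-h * u)) :=
    hKi.mul_bdd (c := B) (hφm.comp (measurable_const_mul (-h))).aestronglyMeasurable (Filter.Eventually.of_forall fun u => hφB _)
  have hsumI : Integrable (fun u => ∑ k ∈ Finset.range (n+1), K u * (φ k 0 * ((-h * u) ^ k / (k.factorial : ℝ)))) := by
    refine integrable_finsetSum _ fun k _ => ?_
    refine ((hKp k).mul_const (φ k 0 * (-h)^k / (k.factorial : ℝ))).congr (Filter.Eventually.of_forall fun u => ?_)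
    simp only [mul_pow]; ring
  have hsum : ∫ u, ∑ k ∈ Finset.range (n+1), K u * (φ k 0 * ((-h * u) ^ k / (k.factorial : ℝ))) = φ 0 0 := by
    rw [integral_finsetSum]
    · rw [Finset.sum_range_succ', Finset.sum_eq_zero]
      · simp [integral_mul_const, hK_int]
      · intro k hk
        have : ∀ u, K u * (φ (k+1) 0 * ((-h * u) ^ (k+1) / ((k+1).factorial : ℝ))) =
          (K u * u ^ (k+1)) * (φ (k+1) 0 * (-h)^(k+1) / ((k+1).factorial : ℝ)) := by
          intro u; rw [mul_pow]; ring
        simp_rw [this]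
        rw [integral_mul_const, hK_mom (k+1) (by omega) (by have := Finset.mem_range.1 hk; omega), zero_mul]
    · intro k _
      refine ((hKp k).mul_const (φ k 0 * (-h)^k / (k.factorial : ℝ))).congr (Filter.Eventually.of_forall fun u => ?_)
      simp only [mul_pow]; ring
  have hsub : (∫ u, K u * φ 0 (-h * u)) - φ 0 0 =
      ∫ u, K u * (φ 0 (-h * u) - ∑ k ∈ Finset.range (n+1), φ k 0 * ((-h * u) ^ k / (k.factorial : ℝ))) := by
    conv_lhs => rw [← hsum]
    rw [← integral_sub hKφ hsumI]
    congr 1; ext u; rw [mul_sub, Finset.mul_sum]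
  rw [hsub, ← setIntegral_eq_integral_of_forall_compl_eq_zero (s := Set.Icc (-1:ℝ) 1)
    (fun x hx => by rw [hK0 x hx, zero_mul])]
  have := norm_setIntegral_le_of_norm_le_const (μ := volume) (s := Set.Icc (-1:ℝ) 1) (C := MK * (L * h ^ (n + γ)))
    (f := fun u => K u * (φ 0 (-h * u) - ∑ k ∈ Finset.range (n+1), φ k 0 * ((-h * u) ^ k / (k.factorial : ℝ))))
    (by simp) (by
      intro u hu
      rw [norm_mul]
      have h1 := taylor_aux L γ hL hγ n φ hd hh (-h * u)
      refine mul_le_mul (hK_bdd u) (h1.trans ?_) (norm_nonneg _) hMK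
      have hu1 : |u| ≤ 1 := abs_le.2 hu
      have : |-h * u| ≤ h := by
        rw [abs_mul, abs_neg, abs_of_pos hpos]; exact mul_le_of_le_one_right hpos.le hu1
      gcongr)
  rw [Real.norm_eq_abs] at this
  refine this.trans (le_of_eq ?_)
  simp [Measure.real]
  norm_num
  ring

/-- product-kernel bias -/
theorem biasd (A : ℝ) (hA : 1 ≤ A) (d : ℕ) : ∀ (k : Fin d → ℝ → ℝ) (F : (Fin d → ℝ) → ℝ) (C : ℝ) (x B : Fin d → ℝ),
    (∀ i, Integrable (k i)) → (∀ i, ∫ t, |k i t| ≤ A) → Measurable F → (∀ z, |F z| ≤ C) → 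
    (∀ i z, |(∫ t, k i t * F (Function.update z i t)) - F (Function.update z i (x i))| ≤ B i) →
    |(∫ z, (∏ i, k i (z i)) * F z) - F x| ≤ A ^ d * ∑ i, B i := by
  induction d with
  | zero =>
    intro k F C x B _ _ _ _ _
    have : ∀ z, F z = F x := fun z => by rw [Subsingleton.elim z x]
    simp [this, Measure.real, volume_pi]
  | succ d ih =>
    intro k F C x B hk hkA hF hC hB
    have hmp := measurePreserving_piFinSuccAbove (fun _ : Fin (d+1) => (volume : Measure ℝ)) 0
    have hmp' := hmp.symm
    have hB0 : ∀ i, 0 ≤ B i := fun i => (abs_nonneg _).trans (hB i 0)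
    have hcons : Measurable (fun p : ℝ × (Fin d → ℝ) => (Fin.cons p.1 p.2 : Fin (d+1) → ℝ)) := by
      rw [measurable_pi_iff]
      intro i
      refine Fin.cases ?_ (fun j => ?_) i
      · simpa using measurable_fst
      · simp only [Fin.cons_succ]
        exact (measurable_pi_apply j).comp measurable_snd
    have hkprod : Integrable (fun z : Fin d → ℝ => ∏ i, k i.succ (z i)) :=
      Integrable.fintype_prod (f := fun i : Fin d => k i.succ) (fun i => hk _)
    have hint : Integrable (fun p : ℝ × (Fin d → ℝ) => (k 0 p.1 * ∏ i, k i.succ (p.2 i)) * F (Fin.cons p.1 p.2))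
        (volume.prod volume) := by
      refine Integrable.mul_bdd (c := C) ((hk 0).mul_prod hkprod) ?_ (Filter.Eventually.of_forall fun p => hC _)
      exact (hF.comp hcons).aestronglyMeasurable
    have e1 : ∫ z, (∏ i, k i (z i)) * F z = ∫ p : ℝ × (Fin d → ℝ), (k 0 p.1 * ∏ i, k i.succ (p.2 i)) * F (Fin.cons p.1 p.2) ∂(volume.prod volume) := by
      rw [volume_pi, ← hmp'.integral_comp']
      refine integral_congr_ae (Filter.Eventually.of_forall fun p => ?_)
      simp [MeasurableEquiv.piFinSuccAbove, Fin.prod_univ_succ, Fin.insertNthEquiv]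
    have e2 : ∫ z, (∏ i, k i (z i)) * F z = ∫ y : Fin d → ℝ, (∏ i, k i.succ (y i)) * ∫ t, k 0 t * F (Fin.cons t y) := by
      rw [e1, integral_prod_symm _ hint]
      refine integral_congr_ae (Filter.Eventually.of_forall fun y => ?_)
      simp only
      rw [← integral_const_mul]
      congr 1; ext t; ring
    have hint2 : Integrable (fun y : Fin d → ℝ => (∏ i, k i.succ (y i)) * ∫ t, k 0 t * F (Fin.cons t y)) := by
      refine hint.integral_prod_right.congr (Filter.Eventually.of_forall fun y => ?_)
      simp only
      rw [← integral_const_mul]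
      congr 1; ext t; ring
    have hint3 : Integrable (fun y : Fin d → ℝ => (∏ i, k i.succ (y i)) * F (Fin.cons (x 0) y)) := by
      refine hkprod.mul_bdd (c := C) ?_ (Filter.Eventually.of_forall fun p => hC _)
      exact (hF.comp (hcons.comp (measurable_const.prodMk measurable_id))).aestronglyMeasurable
    have i1 := ih (fun i => k i.succ) (fun y => F (Fin.cons (x 0) y)) C (fun i => x i.succ) (fun i => B i.succ)
      (fun i => hk _) (fun i => hkA _) (hF.comp (hcons.comp (measurable_const.prodMk measurable_id))) (fun _ => hC _)
      (fun i z => by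
        have := hB i.succ (Fin.cons (x 0) z)
        simpa [Fin.cons_update] using this)
    have hx : (Fin.cons (x 0) fun i : Fin d => x i.succ : Fin (d+1) → ℝ) = x := Fin.cons_self_tail x
    rw [hx] at i1
    have hprodA : ∫ y : Fin d → ℝ, |∏ i, k i.succ (y i)| ≤ A ^ d := by
      simp_rw [Finset.abs_prod]
      rw [integral_fintype_prod_volume_eq_prod (f := fun (i : Fin d) t => |k i.succ t|)]
      refine (Finset.prod_le_prod (fun i _ => integral_nonneg fun _ => abs_nonneg _) (fun i _ => hkA _)).trans ?_
      simp
    have i2 : |(∫ z, (∏ i, k i (z i)) * F z) - ∫ y : Fin d → ℝ, (∏ i, k i.succ (y i)) * F (Fin.cons (x 0) y)| ≤ A ^ d * B 0 := by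
      rw [e2, ← integral_sub hint2 hint3]
      calc _ ≤ ∫ y : Fin d → ℝ, |∏ i, k i.succ (y i)| * B 0 := by
            rw [← Real.norm_eq_abs]
            refine norm_integral_le_of_norm_le (hkprod.abs.mul_const _) (Filter.Eventually.of_forall fun y => ?_)
            rw [← mul_sub, norm_mul]
            refine mul_le_mul_of_nonneg_left ?_ (norm_nonneg _)
            have := hB 0 (Fin.cons 0 y)
            simpa [Fin.update_cons_zero] using this
        _ ≤ _ := by
          rw [integral_mul_const]
          exact mul_le_mul_of_nonneg_right hprodA (hB0 0)
    rw [Fin.sum_univ_succ]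
    have hAd : A ^ d ≤ A ^ (d+1) := pow_le_pow_right₀ hA (by omega)
    have hs : 0 ≤ B 0 + ∑ i : Fin d, B i.succ := add_nonneg (hB0 0) (Finset.sum_nonneg fun i _ => hB0 _)
    calc _ ≤ _ := abs_sub_le _ (∫ y : Fin d → ℝ, (∏ i, k i.succ (y i)) * F (Fin.cons (x 0) y)) _
      _ ≤ A ^ d * B 0 + A ^ d * ∑ i : Fin d, B i.succ := add_le_add i2 i1
      _ = A ^ d * (B 0 + ∑ i : Fin d, B i.succ) := by ring
      _ ≤ _ := mul_le_mul_of_nonneg_right hAd hs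

theorem bias_main (d : ℕ) (β L : Fin d → ℝ) (hβ : ∀ i, 0 < β i) (hL : ∀ i, 0 < L i)
    (μ : EuclideanSpace ℝ (Fin d) → ℝ) (hμ_meas : Measurable μ)
    (hμ_nonneg : ∀ x, 0 ≤ μ x) (Cμ : ℝ) (hμ_bdd : ∀ x, μ x ≤ Cμ)
    (hμ_holder : memHolder d β L μ)
    (K : ℝ → ℝ) (hK_meas : Measurable K) (hK_int : ∫ x, K x = 1)
    (MK : ℝ) (hK_bdd : ∀ x, |K x| ≤ MK)
    (hK_supp : Function.support K ⊆ Set.Icc (-1) 1)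
    (M : ℕ) (hM : ∀ i, β i ≤ (M : ℝ))
    (hK_mom : ∀ l : ℕ, 1 ≤ l → l ≤ M → ∫ x, K x * x ^ l = 0)
    (x : EuclideanSpace ℝ (Fin d)) (h : Fin d → ℝ) (hh : ∀ l, 0 < h l) :
    |(∏ l, h l)⁻¹ * (∫ y : EuclideanSpace ℝ (Fin d), (∏ m, K ((x m - y m) / h m)) * μ y) - μ x|
      ≤ (1 + 2 * MK) ^ d * ∑ i, 2 * MK * L i * h i ^ β i := by
  have hMK : 0 ≤ MK := (abs_nonneg _).trans (hK_bdd 0)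
  have hKi : Integrable K := by
    have : IntegrableOn K (Set.Icc (-1) 1) :=
      Measure.integrableOn_of_bounded (M := MK) (by simp) hK_meas.aestronglyMeasurable
        (Filter.Eventually.of_forall hK_bdd)
    rwa [integrableOn_iff_integrable_of_support_subset hK_supp] at this
  have hKabs : ∫ u, |K u| ≤ 2 * MK := by
    rw [← setIntegral_eq_integral_of_forall_compl_eq_zero (s := Set.Icc (-1:ℝ) 1)
      (fun x hx => by
        by_contra hne
        exact hx (hK_supp (fun h0 => hne (by rw [h0, abs_zero]))))]
    have := norm_setIntegral_le_of_norm_le_const (μ := volume) (s := Set.Icc (-1:ℝ) 1) (C := MK)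
      (f := fun u => |K u|) (by simp) (fun u _ => by simpa using hK_bdd u)
    refine (le_abs_self _).trans (this.trans (le_of_eq ?_))
    simp [Measure.real]
    norm_num
    ring
  have hsubst : ∀ (i : Fin d) (a : ℝ) (G : ℝ → ℝ), ∫ t, (h i)⁻¹ * G ((a - t) / h i) = ∫ u, G u := by
    intro i a G
    rw [integral_const_mul, integral_sub_left_eq_self (fun s => G (s / h i)) volume a,
      Measure.integral_comp_div, abs_of_pos (hh i), smul_eq_mul, ← mul_assoc,
      inv_mul_cancel₀ (hh i).ne', one_mul]
  have hToLp : Measurable (fun z : Fin d → ℝ => (WithLp.toLp 2 z : EuclideanSpace ℝ (Fin d))) :=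
    (MeasurableEquiv.toLp 2 (Fin d → ℝ)).measurable
  have hμabs : ∀ y, |μ y| ≤ Cμ := fun y => by rw [abs_of_nonneg (hμ_nonneg y)]; exact hμ_bdd y
  have key := biasd (1 + 2 * MK) (by linarith) d (fun i t => (h i)⁻¹ * K ((x i - t) / h i))
    (fun z => μ (WithLp.toLp 2 z)) Cμ (fun i => x i) (fun i => 2 * MK * L i * h i ^ β i)
    (fun i => by
      refine Integrable.const_mul ?_ _
      exact ((hKi.comp_div (hh i).ne').comp_sub_left (x i)))
    (fun i => by
      have := hsubst i (x i) (fun u => |K u|)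
      simp_rw [abs_mul, abs_of_pos (inv_pos.2 (hh i))]
      rw [this]; linarith)
    (hμ_meas.comp hToLp) (fun z => hμabs _)
    (fun i z => by
      obtain ⟨_, hdiff, hhol⟩ := hμ_holder i
      set n := flr (β i) with hn
      have hnβ : (n : ℝ) < β i := by
        have h1 : 0 < ⌈β i⌉₊ := Nat.ceil_pos.2 (hβ i)
        have h2 : n < ⌈β i⌉₊ := by rw [hn, flr]; omega
        exact Nat.lt_ceil.1 h2
      have hnM : n ≤ M := by
        have := hnβ.le.trans (hM i); exact_mod_cast this
      set w : EuclideanSpace ℝ (Fin d) := WithLp.toLp 2 (Function.update z i (x i)) with hw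
      have hupd : ∀ s : ℝ, (WithLp.toLp 2 (Function.update z i (x i + s)) : EuclideanSpace ℝ (Fin d)) =
          w + s • EuclideanSpace.single i 1 := by
        intro s
        ext j
        rcases eq_or_ne j i with rfl | hj
        · simp [hw]
        · simp [hw, hj]
      have hline : ∀ s : ℝ, HasDerivAt (fun s : ℝ => w + s • (EuclideanSpace.single i 1 : EuclideanSpace ℝ (Fin d)))
          (EuclideanSpace.single i 1) s := by
        intro s
        simpa using ((hasDerivAt_id s).smul_const (EuclideanSpace.single i 1 : EuclideanSpace ℝ (Fin d))).const_add w
      have b := bias1 (L i) (β i - n) (hL i).le (by linarith) n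
        (fun k s => pderivIter d i k μ (w + s • EuclideanSpace.single i 1))
        (fun k hk s => ((hdiff k hk _).hasFDerivAt.comp_hasDerivAt s (hline s)))
        (fun s => by simpa using hhol s w)
        (hμ_meas.comp (by fun_prop)) Cμ (fun s => hμabs _) K hK_meas hK_int MK hK_bdd hK_supp
        (fun l h1 h2 => hK_mom l h1 (h2.trans hnM)) (h i) (hh i)
      have e : ∫ t, (h i)⁻¹ * K ((x i - t) / h i) * μ (WithLp.toLp 2 (Function.update z i t)) =
          ∫ u, K u * μ (w + (-h i * u) • EuclideanSpace.single i 1) := by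
        rw [← hsubst i (x i) (fun u => K u * μ (w + (-h i * u) • EuclideanSpace.single i 1))]
        congr 1; ext t
        simp only
        have : x i + -h i * ((x i - t) / h i) = t := by
          have := (hh i).ne'
          field_simp; ring
        rw [← hupd, mul_assoc, this]
      simp only
      rw [e]
      simpa [pderivIter] using b)
  have e : (∏ l, h l)⁻¹ * (∫ y : EuclideanSpace ℝ (Fin d), (∏ m, K ((x m - y m) / h m)) * μ y) =
      ∫ z : Fin d → ℝ, (∏ i, (h i)⁻¹ * K ((x i - z i) / h i)) * μ (WithLp.toLp 2 z) := by
    have := (EuclideanSpace.volume_preserving_symm_measurableEquiv_toLp (Fin d)).symm.integral_comp'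
      (g := fun y : EuclideanSpace ℝ (Fin d) => (∏ m, K ((x m - y m) / h m)) * μ y)
    rw [← this, ← integral_const_mul]
    congr 1; ext z
    rw [Finset.prod_mul_distrib, Finset.prod_inv_distrib, ← mul_assoc]
    rfl
  rw [e]
  exact key

theorem var_mse {Ω : Type*} [MeasurableSpace Ω] (P : Measure Ω) [IsProbabilityMeasure P]
    (Y : Ω → ℝ) (hY : Measurable Y) (B : ℝ) (hB : ∀ ω, |Y ω| ≤ B) (c m : ℝ) :
    ∫ ω, (c * Y ω - m) ^ 2 ∂P ≤ 2 * c ^ 2 * (∫ ω, (Y ω - ∫ ω', Y ω' ∂P) ^ 2 ∂P)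
      + 2 * (c * (∫ ω, Y ω ∂P) - m) ^ 2 := by
  have hLp : MemLp Y 2 P := MemLp.of_bound hY.aestronglyMeasurable B (Filter.Eventually.of_forall hB)
  set E := ∫ ω, Y ω ∂P
  have h1 : Integrable (fun ω => (c * Y ω - m) ^ 2) P :=
    ((hLp.const_mul c).sub (memLp_const m)).integrable_sq
  have h2 : Integrable (fun ω => (Y ω - E) ^ 2) P := (hLp.sub (memLp_const E)).integrable_sq
  calc _ ≤ ∫ ω, (2 * c ^ 2 * (Y ω - E) ^ 2 + 2 * (c * E - m) ^ 2) ∂P := by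
        refine integral_mono h1 ((h2.const_mul _).add (integrable_const _)) fun ω => ?_
        simp only
        nlinarith [sq_nonneg (c * (Y ω - E) - (c * E - m))]
    _ = _ := by
      rw [integral_add (h2.const_mul _) (integrable_const _), integral_const_mul]
      simp

theorem risk_i {Ω : Type*} [MeasurableSpace Ω] (P : Measure Ω) [IsProbabilityMeasure P]
    (d : ℕ) (hd : 3 ≤ d)
    (β L : Fin d → ℝ) (hβ : ∀ i, 0 < β i) (hL : ∀ i, 0 < L i)
    (X : ℝ → Ω → EuclideanSpace ℝ (Fin d))
    (hX : Measurable (Function.uncurry X))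
    (hstat : ∀ (n : ℕ) (t : Fin n → ℝ) (s : ℝ), 0 ≤ s → (∀ i, 0 ≤ t i) →
      P.map (fun ω i => X (t i + s) ω) = P.map (fun ω i => X (t i) ω))
    (μ : EuclideanSpace ℝ (Fin d) → ℝ) (hμ_meas : Measurable μ)
    (hμ_nonneg : ∀ x, 0 ≤ μ x) (Cμ : ℝ) (hμ_bdd : ∀ x, μ x ≤ Cμ)
    (hμ_density : P.map (X 0) = volume.withDensity (fun x => ENNReal.ofReal (μ x)))
    (hμ_holder : memHolder d β L μ)
    (C₀ : ℝ)
    (hvar : ∀ T > (0 : ℝ), ∀ f : EuclideanSpace ℝ (Fin d) → ℝ, ∀ Mf : ℝ,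
      Measurable f → (∀ x, |f x| ≤ Mf) → volume (Function.support f) < 1 →
      (∫ ω, ((∫ t in Set.Icc 0 T, f (X t ω))
          - ∫ ω', (∫ t in Set.Icc 0 T, f (X t ω')) ∂P) ^ 2 ∂P)
        ≤ C₀ * T * Mf ^ 2 *
          (volume (Function.support f)).toReal ^ (1 + 2 / (d : ℝ)))
    (K : ℝ → ℝ) (hK_meas : Measurable K) (hK_int : ∫ x, K x = 1)
    (MK : ℝ) (hK_bdd : ∀ x, |K x| ≤ MK)
    (hK_supp : Function.support K ⊆ Set.Icc (-1) 1)
    (M : ℕ) (hM : ∀ i, β i ≤ (M : ℝ))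
    (hK_mom : ∀ l : ℕ, 1 ≤ l → l ≤ M → ∫ x, K x * x ^ l = 0) :
    ∃ C : ℝ, 0 ≤ C ∧
      (∀ (x : EuclideanSpace ℝ (Fin d)) (T : ℝ) (h : Fin d → ℝ), 0 < T →
        (∀ l, h l ∈ Set.Ioc (0 : ℝ) 1) → 2 ^ d * ∏ l, h l < 1 →
        (∫ ω, ((1 / (T * ∏ l, h l)) *
            (∫ u in Set.Icc 0 T, ∏ m, K ((x m - X u ω m) / h m)) - μ x) ^ 2 ∂P)
          ≤ C * ((∑ l, h l ^ (2 * β l)) + T⁻¹ * (∏ l, h l) ^ (2 / (d : ℝ) - 1))) := by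
  have hMK : 0 ≤ MK := (abs_nonneg _).trans (hK_bdd 0)
  set C1 : ℝ := 2 * (|C₀| * (MK ^ d) ^ 2 * (2 ^ d) ^ (1 + 2 / (d:ℝ))) with hC1
  set C2 : ℝ := 2 * (((1 + 2 * MK) ^ d) ^ 2 * (d * ((2 * MK) ^ 2 * ∑ i, L i ^ 2))) with hC2
  have hC1' : 0 ≤ C1 := by positivity
  have hC2' : 0 ≤ C2 := by positivity
  refine ⟨C1 + C2, by positivity, ?_⟩
  intro x T h hT hh hsmall
  have hhpos : ∀ l, 0 < h l := fun l => (hh l).1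
  set H : ℝ := ∏ l, h l with hH
  have hHpos : 0 < H := Finset.prod_pos fun l _ => hhpos l
  set f : EuclideanSpace ℝ (Fin d) → ℝ := fun y => ∏ m, K ((x m - y m) / h m) with hf
  have hfm : Measurable f := by
    refine Finset.measurable_fun_prod _ fun m _ => hK_meas.comp ?_
    fun_prop
  have hfb : ∀ y, |f y| ≤ MK ^ d := by
    intro y
    rw [hf]
    simp only
    rw [Finset.abs_prod]
    refine (Finset.prod_le_prod (fun i _ => abs_nonneg _) (fun i _ => hK_bdd _)).trans ?_
    simp
  have hsupp : Function.support f ⊆ (fun y : EuclideanSpace ℝ (Fin d) => y.ofLp) ⁻¹'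
      (Set.Icc (fun m => x m - h m) (fun m => x m + h m)) := by
    intro y hy
    have : ∀ m, K ((x m - y m) / h m) ≠ 0 := fun m hm =>
      hy (Finset.prod_eq_zero (Finset.mem_univ m) hm)
    have h2 : ∀ m, -1 ≤ (x m - y m) / h m ∧ (x m - y m) / h m ≤ 1 := fun m => hK_supp (this m)
    have h3 : ∀ m, x m - h m ≤ y m ∧ y m ≤ x m + h m := by
      intro m
      have h4 := h2 m
      rw [le_div_iff₀ (hhpos m), div_le_iff₀ (hhpos m)] at h4
      constructor <;> linarith [h4.1, h4.2]
    exact ⟨fun m => (h3 m).1, fun m => (h3 m).2⟩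
  have hvol : volume (Function.support f) ≤ ENNReal.ofReal (2 ^ d * H) := by
    refine (measure_mono hsupp).trans ?_
    have := (EuclideanSpace.volume_preserving_symm_measurableEquiv_toLp (Fin d)).measure_preimage
      (s := Set.Icc (fun m => x m - h m) (fun m => x m + h m)) measurableSet_Icc.nullMeasurableSet
    refine (le_of_eq this).trans ?_
    rw [Real.volume_Icc_pi, ← ENNReal.ofReal_prod_of_nonneg (fun i _ => by linarith [hhpos i])]
    refine ENNReal.ofReal_le_ofReal (le_of_eq ?_)
    have : ∀ i, x i + h i - (x i - h i) = 2 * h i := fun i => by ring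
    simp_rw [this]
    rw [Finset.prod_mul_distrib]
    simp [hH]
  have hvol1 : volume (Function.support f) < 1 := by
    refine hvol.trans_lt ?_
    rw [← ENNReal.ofReal_one]
    exact (ENNReal.ofReal_lt_ofReal_iff one_pos).2 hsmall
  have hvolR : (volume (Function.support f)).toReal ≤ 2 ^ d * H :=
    ENNReal.toReal_le_of_le_ofReal (by positivity) hvol
  have hV := hvar T hT f (MK ^ d) hfm hfb hvol1
  set Y : Ω → ℝ := fun ω => ∫ t in Set.Icc 0 T, f (X t ω) with hY
  have hunc : Measurable (fun p : Ω × ℝ => f (X p.2 p.1)) :=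
    hfm.comp (hX.comp measurable_swap)
  have hYm : Measurable Y :=
    (StronglyMeasurable.integral_prod_right' (ν := volume.restrict (Set.Icc 0 T))
      hunc.stronglyMeasurable).measurable
  have hYb : ∀ ω, |Y ω| ≤ MK ^ d * T := by
    intro ω
    have := norm_setIntegral_le_of_norm_le_const (μ := volume) (s := Set.Icc 0 T) (C := MK ^ d)
      (f := fun t => f (X t ω)) (by simp) (fun u _ => hfb _)
    simpa [Measure.real, hT.le] using this
  have hXm : ∀ t, Measurable (X t) := fun t => hX.comp (measurable_const.prodMk measurable_id)
  have hmap : ∀ t, 0 ≤ t → P.map (X t) = P.map (X 0) := by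
    intro t ht
    have h1 := hstat 1 (fun _ => 0) t ht (fun _ => le_rfl)
    have h2 := congrArg (fun ν => Measure.map (fun v : Fin 1 → EuclideanSpace ℝ (Fin d) => v 0) ν) h1
    rw [Measure.map_map (measurable_pi_apply 0) (by fun_prop), Measure.map_map (measurable_pi_apply 0) (by fun_prop)] at h2
    simpa [Function.comp_def] using h2
  have hEt : ∀ t, 0 ≤ t → ∫ ω, f (X t ω) ∂P = ∫ y, f y * μ y := by
    intro t ht
    rw [← integral_map (hXm t).aemeasurable hfm.aestronglyMeasurable, hmap t ht, hμ_density,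
      integral_withDensity_eq_integral_toReal_smul (by fun_prop) (by simp)]
    congr 1; ext y
    rw [ENNReal.toReal_ofReal (hμ_nonneg y), smul_eq_mul, mul_comm]
  have hEY : ∫ ω, Y ω ∂P = T * ∫ y, f y * μ y := by
    rw [hY]
    rw [integral_integral_swap]
    · rw [setIntegral_congr_fun measurableSet_Icc (fun t ht => hEt t ht.1)]
      simp [Measure.real, hT.le]
    · exact Integrable.of_bound hunc.aestronglyMeasurable (MK ^ d) (Filter.Eventually.of_forall fun p => hfb _)
  have hmse := var_mse P Y hYm _ hYb (1 / (T * H)) (μ x)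
  refine hmse.trans ?_
  have hbias := bias_main d β L hβ hL μ hμ_meas hμ_nonneg Cμ hμ_bdd hμ_holder K hK_meas hK_int MK hK_bdd
    hK_supp M hM hK_mom x h hhpos
  have hb2 : 2 * (1 / (T * H) * (∫ ω, Y ω ∂P) - μ x) ^ 2 ≤ C2 * ∑ l, h l ^ (2 * β l) := by
    have e : 1 / (T * H) * (∫ ω, Y ω ∂P) = H⁻¹ * ∫ y, f y * μ y := by
      rw [hEY]; field_simp
    rw [e, ← sq_abs]
    have h1 := pow_le_pow_left₀ (abs_nonneg _) hbias 2
    have h2 : (∑ i, 2 * MK * L i * h i ^ β i) ^ 2 ≤ d * ((2 * MK) ^ 2 * ∑ i, L i ^ 2) * ∑ l, h l ^ (2 * β l) := by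
      refine (sq_sum_le_card_mul_sum_sq (s := Finset.univ)).trans ?_
      rw [Finset.card_univ, Fintype.card_fin, mul_assoc]
      refine mul_le_mul_of_nonneg_left ?_ (Nat.cast_nonneg _)
      rw [Finset.mul_sum]
      refine Finset.sum_le_sum fun i _ => ?_
      have e2 : h i ^ (2 * β i) = (h i ^ β i) ^ 2 := by
        rw [mul_comm, Real.rpow_mul (hhpos i).le]; norm_cast
      rw [e2, mul_pow, mul_pow]
      refine mul_le_mul_of_nonneg_right (mul_le_mul_of_nonneg_left ?_ (by positivity)) (by positivity)
      exact Finset.single_le_sum (f := fun i => L i ^ 2) (fun i _ => sq_nonneg _) (Finset.mem_univ i)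
    calc _ ≤ 2 * ((1 + 2 * MK) ^ d * ∑ i, 2 * MK * L i * h i ^ β i) ^ 2 :=
          mul_le_mul_of_nonneg_left h1 (by norm_num)
      _ = 2 * ((1 + 2 * MK) ^ d) ^ 2 * (∑ i, 2 * MK * L i * h i ^ β i) ^ 2 := by ring
      _ ≤ 2 * ((1 + 2 * MK) ^ d) ^ 2 * (d * ((2 * MK) ^ 2 * ∑ i, L i ^ 2) * ∑ l, h l ^ (2 * β l)) :=
          mul_le_mul_of_nonneg_left h2 (by positivity)
      _ = _ := by rw [hC2]; ring
  have hv2 : 2 * (1 / (T * H)) ^ 2 * (∫ ω, (Y ω - ∫ ω', Y ω' ∂P) ^ 2 ∂P) ≤ C1 * (T⁻¹ * H ^ (2 / (d:ℝ) - 1)) := by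
    have h1 : (∫ ω, (Y ω - ∫ ω', Y ω' ∂P) ^ 2 ∂P) ≤ |C₀| * T * (MK ^ d) ^ 2 * (2 ^ d * H) ^ (1 + 2 / (d:ℝ)) := by
      refine hV.trans ?_
      have : C₀ ≤ |C₀| := le_abs_self _
      gcongr
    refine (mul_le_mul_of_nonneg_left h1 (by positivity)).trans (le_of_eq ?_)
    rw [Real.mul_rpow (by positivity) hHpos.le]
    have e : H ^ (1 + 2 / (d:ℝ)) = H ^ (2 / (d:ℝ) - 1) * H ^ 2 := by
      rw [← Real.rpow_natCast, ← Real.rpow_add hHpos]; congr 1; push_cast; ring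
    rw [e, hC1]
    field_simp
  have hS : 0 ≤ ∑ l, h l ^ (2 * β l) := Finset.sum_nonneg fun l _ => Real.rpow_nonneg (hhpos l).le _
  have hR : 0 ≤ T⁻¹ * H ^ (2 / (d:ℝ) - 1) := by positivity
  nlinarith [mul_nonneg hC1' hS, mul_nonneg hC2' hR]

/-- Pointwise convergence rate for the kernel invariant-density
estimator, case `d ≥ 3`: (i) bias–variance risk bound
`E|μ̂_{h,T}(x)-μ(x)|² ≤ C(Σ_l h_l^{2β_l} + T⁻¹(∏_l h_l)^{2/d-1})`; and (ii) with the
rate-optimal bandwidth `h_l(T) = T^{-β̄/(β_l(2β̄+d-2))}`, the risk is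
`≤ C T^{-2β̄/(2β̄+d-2)}` for all large `T`. -/
theorem stmt15 {Ω : Type*} [MeasurableSpace Ω] (P : Measure Ω) [IsProbabilityMeasure P]
    (d : ℕ) (hd : 3 ≤ d)
    (β L : Fin d → ℝ) (hβ : ∀ i, 0 < β i) (hL : ∀ i, 0 < L i)
    (X : ℝ → Ω → EuclideanSpace ℝ (Fin d))
    (hX : Measurable (Function.uncurry X))
    (hstat : ∀ (n : ℕ) (t : Fin n → ℝ) (s : ℝ), 0 ≤ s → (∀ i, 0 ≤ t i) →
      P.map (fun ω i => X (t i + s) ω) = P.map (fun ω i => X (t i) ω))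
    (μ : EuclideanSpace ℝ (Fin d) → ℝ) (hμ_meas : Measurable μ)
    (hμ_nonneg : ∀ x, 0 ≤ μ x) (Cμ : ℝ) (hμ_bdd : ∀ x, μ x ≤ Cμ)
    (hμ_density : P.map (X 0) = volume.withDensity (fun x => ENNReal.ofReal (μ x)))
    (hμ_holder : memHolder d β L μ)
    (C₀ : ℝ)
    (hvar : ∀ T > (0 : ℝ), ∀ f : EuclideanSpace ℝ (Fin d) → ℝ, ∀ Mf : ℝ,
      Measurable f → (∀ x, |f x| ≤ Mf) → volume (Function.support f) < 1 →
      (∫ ω, ((∫ t in Set.Icc 0 T, f (X t ω))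
          - ∫ ω', (∫ t in Set.Icc 0 T, f (X t ω')) ∂P) ^ 2 ∂P)
        ≤ C₀ * T * Mf ^ 2 *
          (volume (Function.support f)).toReal ^ (1 + 2 / (d : ℝ)))
    (K : ℝ → ℝ) (hK_meas : Measurable K) (hK_int : ∫ x, K x = 1)
    (MK : ℝ) (hK_bdd : ∀ x, |K x| ≤ MK)
    (hK_supp : Function.support K ⊆ Set.Icc (-1) 1)
    (M : ℕ) (hM : ∀ i, β i ≤ (M : ℝ))
    (hK_mom : ∀ l : ℕ, 1 ≤ l → l ≤ M → ∫ x, K x * x ^ l = 0)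
    (βbar : ℝ) (hβbar : 1 / βbar = (1 / (d : ℝ)) * ∑ l, 1 / β l) :
    ∃ C : ℝ,
      (∀ (x : EuclideanSpace ℝ (Fin d)) (T : ℝ) (h : Fin d → ℝ), 0 < T →
        (∀ l, h l ∈ Set.Ioc (0 : ℝ) 1) → 2 ^ d * ∏ l, h l < 1 →
        (∫ ω, ((1 / (T * ∏ l, h l)) *
            (∫ u in Set.Icc 0 T, ∏ m, K ((x m - X u ω m) / h m)) - μ x) ^ 2 ∂P)
          ≤ C * ((∑ l, h l ^ (2 * β l)) + T⁻¹ * (∏ l, h l) ^ (2 / (d : ℝ) - 1))) ∧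
      (∃ T₀ : ℝ, ∀ T ≥ T₀, ∀ x : EuclideanSpace ℝ (Fin d),
        (∫ ω, ((1 / (T * ∏ l, T ^ (-(βbar / (β l * (2 * βbar + (d : ℝ) - 2)))))) *
            (∫ u in Set.Icc 0 T,
              ∏ m, K ((x m - X u ω m) / T ^ (-(βbar / (β m * (2 * βbar + (d : ℝ) - 2))))))
            - μ x) ^ 2 ∂P)
          ≤ C * T ^ (-(2 * βbar / (2 * βbar + (d : ℝ) - 2)))) := by
  obtain ⟨C, hC, hi⟩ := risk_i P d hd β L hβ hL X hX hstat μ hμ_meas hμ_nonneg Cμ hμ_bdd hμ_density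
    hμ_holder C₀ hvar K hK_meas hK_int MK hK_bdd hK_supp M hM hK_mom
  have hdR : (3:ℝ) ≤ d := by exact_mod_cast hd
  have hd0 : (0:ℝ) < d := by linarith
  have hne : (Finset.univ : Finset (Fin d)).Nonempty := ⟨⟨0, by omega⟩, Finset.mem_univ _⟩
  have hSpos : 0 < ∑ l, 1 / β l := Finset.sum_pos (fun l _ => one_div_pos.2 (hβ l)) hne
  have hbpos : 0 < βbar := by
    rw [← one_div_pos, hβbar]; positivity
  set D : ℝ := 2 * βbar + (d : ℝ) - 2 with hD
  have hDpos : 0 < D := by rw [hD]; linarith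
  have hsum : ∑ l, βbar / (β l * D) = d / D := by
    have h1 : ∑ l, βbar / (β l * D) = βbar / D * ∑ l, 1 / β l := by
      rw [Finset.mul_sum]
      refine Finset.sum_congr rfl fun l _ => ?_
      have := (hβ l).ne'
      field_simp
    have h2 : ∑ l, 1 / β l = d / βbar := by
      field_simp at hβbar
      field_simp
      linarith
    rw [h1, h2]; field_simp
  refine ⟨(d + 1) * C, ?_, ?_⟩
  · intro x T h hT hh hs
    refine (hi x T h hT hh hs).trans ?_
    have hHpos : 0 < ∏ l, h l := Finset.prod_pos fun l _ => (hh l).1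
    have hS : 0 ≤ ∑ l, h l ^ (2 * β l) := Finset.sum_nonneg fun l _ => Real.rpow_nonneg (hh l).1.le _
    refine mul_le_mul_of_nonneg_right ?_ (by positivity)
    nlinarith
  · have hlim : Filter.Tendsto (fun T : ℝ => (2:ℝ) ^ d * T ^ (-((d:ℝ) / D))) Filter.atTop (nhds (2 ^ d * 0)) :=
      (tendsto_rpow_neg_atTop (by positivity)).const_mul _
    rw [mul_zero] at hlim
    obtain ⟨T₁, hT₁⟩ := Filter.eventually_atTop.1 (hlim.eventually (gt_mem_nhds one_pos))
    refine ⟨max 1 T₁, fun T hT x => ?_⟩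
    have hT1 : 1 ≤ T := (le_max_left _ _).trans hT
    have hT0 : 0 < T := by linarith
    have hprod : ∏ l, T ^ (-(βbar / (β l * D))) = T ^ (-((d:ℝ) / D)) := by
      rw [← Real.rpow_sum_of_pos hT0, Finset.sum_neg_distrib, hsum]
    have key := hi x T (fun l => T ^ (-(βbar / (β l * D)))) hT0
      (fun l => ⟨Real.rpow_pos_of_pos hT0 _, Real.rpow_le_one_of_one_le_of_nonpos hT1 (by
        have := hβ l
        have : 0 < βbar / (β l * D) := by positivity
        linarith)⟩) (by
        rw [hprod]; exact hT₁ T ((le_max_right _ _).trans hT))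
    refine key.trans (le_of_eq ?_)
    have e1 : ∀ l, (T ^ (-(βbar / (β l * D)))) ^ (2 * β l) = T ^ (-(2 * βbar / D)) := by
      intro l
      rw [← Real.rpow_mul hT0.le]
      congr 1
      have := (hβ l).ne'
      field_simp
    have e2 : T⁻¹ * (∏ l, T ^ (-(βbar / (β l * D)))) ^ (2 / (d:ℝ) - 1) = T ^ (-(2 * βbar / D)) := by
      rw [hprod, ← Real.rpow_mul hT0.le, ← Real.rpow_neg_one T, ← Real.rpow_add hT0]
      congr 1
      field_simp
      rw [hD]; ring
    simp only [e1, e2]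
    simp
    ring
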